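/- Fix a real number x ≥ 0 and b ∈ (0,1), and for each positive integer N set n = ⌊bN⌋. Then the discrete Chebyshev polynomial satisfies the asymptotic relation (-1)^{n+1} · π · t_n(x, N+1) · Γ(N+1) · N^{-x} · n^{2x+2} / (Γ(n+N+2) · Γ(x+1)) → sin(πx) as N → ∞; equivalently, t_n(x, N+1) = (-1)^{n+1} Γ(n+N+2) N^x n^{-2x-2} Γ(x+1) / (Γ(N+1) π) · (sin(πx) + o(1)). -/

import Mathlib

open Finset Filter

/-- Pochhammer rising factorial `(z)_k = z (z+1) ⋯ (z+k-1)`. -/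
noncomputable def poch (z : ℝ) (k : ℕ) : ℝ := ∏ i ∈ Finset.range k, (z + i)

/-- Discrete Chebyshev polynomial `t_n(x, N+1)` for `0 ≤ n ≤ N`:
`t_n(x, N+1) = (-1)^n (N+1-n)_n ∑_{k=0}^n ((-n)_k (-x)_k (n+1)_k)/((-N)_k (k!)^2)`. -/
noncomputable def tcheb (n N : ℕ) (x : ℝ) : ℝ :=
  (-1 : ℝ) ^ n * poch ((N : ℝ) + 1 - n) n *
    ∑ k ∈ Finset.range (n + 1),
      poch (-(n : ℝ)) k * poch (-x) k * poch ((n : ℝ) + 1) k /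
        (poch (-(N : ℝ)) k * ((Nat.factorial k : ℝ)) ^ 2)

/-- The (unnormalized) weight of the `k`-th term of the discrete Chebyshev polynomial. -/
def chebWeight (n N k : ℕ) : ℕ := (n + k).choose n * (N - k).choose (n - k)

/-- The coefficient `(-x)_k / k!`. -/
noncomputable def binomCoeff (x : ℝ) (k : ℕ) : ℝ := poch (-x) k / (k.factorial : ℝ)

lemma poch_succ (z : ℝ) (k : ℕ) : poch z (k + 1) = poch z k * (z + k) := by
  simp [poch, Finset.prod_range_succ]

lemma poch_neg_natCast (n k : ℕ) : poch (-(n : ℝ)) k = (-1) ^ k * (n.descFactorial k : ℝ) := by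
  induction k with
  | zero => simp [poch]
  | succ k ih =>
    rw [poch_succ, ih, Nat.descFactorial_succ]
    rcases le_or_gt k n with h | h
    · push_cast [Nat.cast_sub h]; ring
    · simp [Nat.descFactorial_of_lt h]

lemma poch_natCast_add_one (n k : ℕ) : poch ((n : ℝ) + 1) k = ((n + 1).ascFactorial k : ℝ) := by
  induction k with
  | zero => simp [poch]
  | succ k ih =>
    rw [poch_succ, ih, Nat.ascFactorial_succ]
    push_cast; ring

lemma poch_natCast_add_one_sub {n N : ℕ} (h : n ≤ N) :
    poch ((N : ℝ) + 1 - n) n = (N.descFactorial n : ℝ) := by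
  have : (N : ℝ) + 1 - n = ((N - n : ℕ) : ℝ) + 1 := by push_cast [Nat.cast_sub h]; ring
  rw [this, poch_natCast_add_one, ← Nat.add_descFactorial_eq_ascFactorial, Nat.sub_add_cancel h]

lemma descFactorial_mul_eq_chebWeight {n N k : ℕ} (hk : k ≤ n) :
    N.descFactorial n * n.descFactorial k * (n + 1).ascFactorial k =
      n.factorial * chebWeight n N k * N.descFactorial k * k.factorial := by
  rw [← Nat.descFactorial_mul_descFactorial hk, Nat.descFactorial_eq_factorial_mul_choose (N - k),
    Nat.ascFactorial_eq_factorial_mul_choose, ← Nat.factorial_mul_descFactorial hk, chebWeight,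
    Nat.choose_symm_add]
  ring

lemma tcheb_eq_sum_chebWeight {n N : ℕ} (h : n ≤ N) (x : ℝ) :
    tcheb n N x = (-1) ^ n * (n.factorial : ℝ) *
      ∑ k ∈ Finset.range (n + 1), (chebWeight n N k : ℝ) * binomCoeff x k := by
  rw [tcheb, poch_natCast_add_one_sub h, mul_assoc, mul_assoc]
  congr 1
  rw [Finset.mul_sum, Finset.mul_sum]
  refine Finset.sum_congr rfl fun k hk => ?_
  have hkn : k ≤ n := by simpa [Nat.lt_succ_iff] using hk
  have key : (N.descFactorial n : ℝ) * n.descFactorial k * (n + 1).ascFactorial k =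
      n.factorial * chebWeight n N k * N.descFactorial k * k.factorial := by
    exact_mod_cast descFactorial_mul_eq_chebWeight hkn
  have hN : (N.descFactorial k : ℝ) ≠ 0 := by
    have := Nat.descFactorial_pos.2 (hkn.trans h)
    positivity
  have hf : (k.factorial : ℝ) ≠ 0 := by positivity
  have h1 : ((-1 : ℝ)) ^ k ≠ 0 := by simp
  rw [poch_neg_natCast, poch_neg_natCast, poch_natCast_add_one, binomCoeff]
  field_simp
  linear_combination poch (-x) k * key

lemma sum_chebWeight {n N : ℕ} (h : n ≤ N) :
    ∑ k ∈ Finset.range (n + 1), chebWeight n N k = (n + N + 1).choose n := by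
  have h1 := PowerSeries.mk_one_pow_eq_mk_choose_add ℤ n
  have h2 := PowerSeries.mk_one_pow_eq_mk_choose_add ℤ (N - n)
  have h3 := PowerSeries.mk_one_pow_eq_mk_choose_add ℤ (N + 1)
  have h4 : (PowerSeries.mk 1 : PowerSeries ℤ) ^ (n + 1) * PowerSeries.mk 1 ^ (N - n + 1) =
      PowerSeries.mk 1 ^ (N + 1 + 1) := by
    rw [← pow_add]; congr 1; omega
  rw [h1, h2, h3] at h4
  have h5 := congrArg (PowerSeries.coeff n) h4
  simp only [PowerSeries.coeff_mul, PowerSeries.coeff_mk] at h5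
  rw [Finset.Nat.sum_antidiagonal_eq_sum_range_succ
    (fun i j : ℕ => (((n + i).choose n : ℕ) : ℤ) * (((N - n + j).choose (N - n) : ℕ) : ℤ)) n] at h5
  have h6 : (n + N + 1).choose n = (N + 1 + n).choose (N + 1) := by
    rw [show n + N + 1 = n + (N + 1) by ring, Nat.choose_symm_add, add_comm]
  rw [h6]
  zify
  rw [← h5]
  refine Finset.sum_congr rfl fun k hk => ?_
  have hkn : k ≤ n := by simpa [Nat.lt_succ_iff] using hk
  rw [chebWeight, show N - n + (n - k) = N - k by omega]
  push_cast
  congr 2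
  exact Nat.choose_symm_of_eq_add (by omega)

lemma chebWeight_succ_mul {n N k : ℕ} (hk : k < n) (h : n ≤ N) :
    (chebWeight n N (k + 1) : ℝ) * (((N : ℝ) - k) * (k + 1)) =
      chebWeight n N k * ((n + k + 1) * ((n : ℝ) - k)) := by
  obtain ⟨d, rfl⟩ := Nat.exists_eq_add_of_lt hk
  obtain ⟨e, rfl⟩ := Nat.exists_eq_add_of_le h
  have h1 : (2 * k + d + 2).choose (k + d + 1) * (k + 1) =
      (2 * k + d + 1).choose (k + d + 1) * (2 * k + d + 2) := by
    have := Nat.choose_mul_succ_eq (2 * k + d + 1) (k + d + 1)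
    rw [show 2 * k + d + 1 + 1 - (k + d + 1) = k + 1 by omega] at this
    linarith
  have h2 : (d + e).choose d * (d + e + 1) = (d + e + 1).choose (d + 1) * (d + 1) := by
    rw [mul_comm, Nat.add_one_mul_choose_eq]
  have e1 : chebWeight (k + d + 1) (k + d + 1 + e) (k + 1) =
      (2 * k + d + 2).choose (k + d + 1) * (d + e).choose d := by
    rw [chebWeight]; congr 2 <;> omega
  have e2 : chebWeight (k + d + 1) (k + d + 1 + e) k =
      (2 * k + d + 1).choose (k + d + 1) * (d + e + 1).choose (d + 1) := by
    rw [chebWeight]; congr 2 <;> omega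
  rw [e1, e2]
  have h1' : ((2 * k + d + 2).choose (k + d + 1) : ℝ) * (k + 1) =
      (2 * k + d + 1).choose (k + d + 1) * (2 * k + d + 2) := by exact_mod_cast h1
  have h2' : ((d + e).choose d : ℝ) * (d + e + 1) =
      (d + e + 1).choose (d + 1) * (d + 1) := by exact_mod_cast h2
  push_cast
  linear_combination ((d + e).choose d : ℝ) * (d + e + 1) * h1' +
    (2 * k + d + 1).choose (k + d + 1) * (2 * k + d + 2 : ℝ) * h2'

lemma chebWeight_le_choose {n N k : ℕ} (hk : k ≤ n) (h : n ≤ N) :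
    (chebWeight n N k : ℝ) ≤ (n + N + 1).choose n := by
  rw [← sum_chebWeight h]
  exact_mod_cast Finset.single_le_sum (f := chebWeight n N) (fun _ _ => Nat.zero_le _)
    (Finset.mem_range.2 (Nat.lt_succ_of_le hk))

lemma chebWeight_growth {n N k : ℕ} (hk : k < n) (h : n ≤ N) {ε : ℝ} (hε : 0 ≤ ε)
    (hμ : (1 + ε) * (N * (k + 1)) ≤ n * (n + 1)) :
    (1 + ε) * (chebWeight n N k : ℝ) ≤ chebWeight n N (k + 1) := by
  have hkN : (0 : ℝ) < (N : ℝ) - k := sub_pos.2 (by exact_mod_cast hk.trans_le h)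
  have hD : 0 < ((N : ℝ) - k) * (k + 1) := by positivity
  refine le_of_mul_le_mul_right ?_ hD
  rw [chebWeight_succ_mul hk h, mul_comm (1 + ε), mul_assoc]
  refine mul_le_mul_of_nonneg_left ?_ (Nat.cast_nonneg _)
  have : 0 ≤ ε * ((k : ℝ) * (k + 1)) := by positivity
  nlinarith

lemma chebWeight_decay {n N k : ℕ} (hk : k < n) (h : n ≤ N) {ε : ℝ} (hε : 0 ≤ ε)
    (hμ : (1 + ε) * (n * (n + 1)) ≤ (N : ℝ) * (k + 1)) :
    (1 + ε) * (chebWeight n N (k + 1) : ℝ) ≤ chebWeight n N k := by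
  have hkN : (0 : ℝ) < (N : ℝ) - k := sub_pos.2 (by exact_mod_cast hk.trans_le h)
  have hD : 0 < ((N : ℝ) - k) * (k + 1) := by positivity
  refine le_of_mul_le_mul_right ?_ hD
  rw [mul_assoc, chebWeight_succ_mul hk h, mul_left_comm]
  refine mul_le_mul_of_nonneg_left ?_ (Nat.cast_nonneg _)
  have : 0 ≤ ε * ((k : ℝ) * (k + 1)) := by positivity
  nlinarith

lemma chebWeight_lower_tail {n N : ℕ} (h : n < N) {ε : ℝ} (hε : 0 ≤ ε) (j : ℕ) :
    ∀ k : ℕ, (1 + ε) * (N * ((k : ℝ) + j)) ≤ n * (n + 1) → k ≤ n →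
      (1 + ε) ^ j * (chebWeight n N k : ℝ) ≤ (n + N + 1).choose n := by
  induction j with
  | zero => intro k _ hk; simpa using chebWeight_le_choose hk h.le
  | succ j ih =>
    intro k hμ hk
    have hN : (0 : ℝ) < N := by exact_mod_cast (Nat.zero_le n).trans_lt h
    have hnN : (n : ℝ) + 1 ≤ N := by exact_mod_cast h
    have hμ' : (N : ℝ) * (k + j + 1) ≤ n * (n + 1) := by
      refine le_trans ?_ hμ
      have : 0 ≤ ε * (N * ((k : ℝ) + (j + 1))) := by positivity
      push_cast
      nlinarith
    have hkn : k < n := by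
      have h1 : (k : ℝ) + j + 1 ≤ n := by
        refine le_of_mul_le_mul_left ?_ hN
        have : (n : ℝ) * (n + 1) ≤ n * N := by gcongr
        linarith
      have : k + j + 1 ≤ n := by exact_mod_cast h1
      omega
    have hstep := chebWeight_growth hkn h.le hε
      (le_trans (by gcongr; push_cast; linarith [Nat.cast_nonneg (α := ℝ) j]) hμ)
    have := ih (k + 1) (by push_cast at hμ ⊢; convert hμ using 3; ring) hkn
    calc (1 + ε) ^ (j + 1) * (chebWeight n N k : ℝ)
        = (1 + ε) ^ j * ((1 + ε) * chebWeight n N k) := by ring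
      _ ≤ (1 + ε) ^ j * chebWeight n N (k + 1) := by gcongr
      _ ≤ _ := this

lemma chebWeight_upper_tail {n N : ℕ} (h : n < N) {ε : ℝ} (hε : 0 ≤ ε) (j : ℕ) :
    ∀ k : ℕ, (1 + ε) * (n * (n + 1)) ≤ (N : ℝ) * k → k + j ≤ n →
      (1 + ε) ^ j * (chebWeight n N (k + j) : ℝ) ≤ (n + N + 1).choose n := by
  induction j with
  | zero => intro k _ hk; simpa using chebWeight_le_choose hk h.le
  | succ j ih =>
    intro k hμ hk
    have hstep := chebWeight_decay (k := k + j) (by omega) h.le hε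
      (hμ.trans (by gcongr; push_cast; linarith [Nat.cast_nonneg (α := ℝ) j]))
    calc (1 + ε) ^ (j + 1) * (chebWeight n N (k + (j + 1)) : ℝ)
        = (1 + ε) ^ j * ((1 + ε) * chebWeight n N (k + j + 1)) := by rw [add_assoc]; ring
      _ ≤ (1 + ε) ^ j * chebWeight n N (k + j) := by gcongr
      _ ≤ _ := ih k hμ (by omega)

lemma tendsto_binomCoeff_mul_rpow (x : ℝ) (hx : 0 ≤ x) :
    Tendsto (fun k : ℕ => binomCoeff x k * (k : ℝ) ^ (x + 1)) atTop
      (nhds (-(Real.sin (Real.pi * x) * Real.Gamma (x + 1) / Real.pi))) := by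
  by_cases hm : ∃ m : ℕ, x = m
  · obtain ⟨m, rfl⟩ := hm
    rw [mul_comm Real.pi, Real.sin_nat_mul_pi]
    simp only [zero_mul, zero_div, neg_zero]
    refine tendsto_const_nhds.congr' ?_
    filter_upwards [eventually_gt_atTop m] with k hk
    rw [binomCoeff, poch_neg_natCast, Nat.descFactorial_of_lt hk]
    simp
  · have hG : Real.Gamma (-x) ≠ 0 := by
      rw [Ne, Real.Gamma_eq_zero_iff]
      rintro ⟨m, h⟩
      exact hm ⟨m, neg_injective h⟩
    have hL : -(Real.sin (Real.pi * x) * Real.Gamma (x + 1) / Real.pi) =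
        (Real.Gamma (-x))⁻¹ * 1 := by
      have h1 := Real.Gamma_mul_Gamma_one_sub (-x)
      have h2 : Real.Gamma (x + 1) ≠ 0 := (Real.Gamma_pos_of_pos (by linarith)).ne'
      rw [show 1 - -x = x + 1 by ring, mul_neg, Real.sin_neg] at h1
      have h3 : Real.sin (Real.pi * x) ≠ 0 := by
        intro h0
        rw [h0] at h1
        simp [hG, h2] at h1
      have hpi := Real.pi_ne_zero
      rw [eq_div_iff (neg_ne_zero.2 h3)] at h1
      rw [mul_one]
      refine eq_inv_of_mul_eq_one_left ?_
      rw [neg_mul, div_mul_eq_mul_div, ← neg_div, div_eq_one_iff_eq hpi]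
      linear_combination h1
    rw [hL]
    have hfrac : Tendsto (fun k : ℕ => (k : ℝ) / (k + -x)) atTop (nhds 1) :=
      tendsto_natCast_div_add_atTop (-x)
    refine (((Real.GammaSeq_tendsto_Gamma (-x)).inv₀ hG).mul hfrac).congr' ?_
    filter_upwards [eventually_gt_atTop 0, eventually_gt_atTop ⌈x⌉₊] with k hk hkx
    have hk0 : (0 : ℝ) < k := by exact_mod_cast hk
    have hkx' : (k : ℝ) + -x ≠ 0 := by
      have := Nat.lt_of_ceil_lt hkx
      linarith
    have hp : (k : ℝ) ^ x ≠ 0 := (Real.rpow_pos_of_pos hk0 x).ne'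
    rw [Real.GammaSeq, Finset.prod_range_succ, binomCoeff, poch, Real.rpow_add hk0,
      Real.rpow_one, Real.rpow_neg hk0.le, inv_div]
    generalize ∏ i ∈ Finset.range k, (-x + (i : ℝ)) = P
    rw [add_comm (-x) (k : ℝ)]
    have hf : (k.factorial : ℝ) ≠ 0 := by positivity
    field_simp

lemma tendsto_mul_rpow_mul_pow_floor (A C D s : ℝ) {ε : ℝ} (hε : 0 < ε) :
    Tendsto (fun μ : ℝ => A * μ * (C * μ ^ s + D) * ((1 + ε) ^ ⌊ε * μ⌋₊)⁻¹) atTop (nhds 0) := by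
  set r : ℝ := ε * Real.log (1 + ε) with hr
  have hr0 : 0 < r := mul_pos hε (Real.log_pos (by linarith))
  have h1 := tendsto_rpow_mul_exp_neg_mul_atTop_nhds_zero (s + 1) r hr0
  have h2 := tendsto_rpow_mul_exp_neg_mul_atTop_nhds_zero 1 r hr0
  have h3 : Tendsto (fun μ : ℝ => (1 + ε) * (|A * C| * (μ ^ (s + 1) * Real.exp (-r * μ)) +
      |A * D| * (μ ^ (1 : ℝ) * Real.exp (-r * μ)))) atTop (nhds 0) := by
    simpa using ((h1.const_mul |A * C|).add (h2.const_mul |A * D|)).const_mul (1 + ε)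
  refine squeeze_zero_norm' ?_ h3
  filter_upwards [eventually_gt_atTop 0] with μ hμ
  have hfloor : ((1 + ε) ^ ⌊ε * μ⌋₊)⁻¹ ≤ (1 + ε) * Real.exp (-r * μ) := by
    have hlt : ε * μ - 1 ≤ (⌊ε * μ⌋₊ : ℝ) := by linarith [Nat.lt_floor_add_one (ε * μ)]
    have hexp : Real.exp (-r * μ) = (1 + ε) ^ (-(ε * μ)) := by
      rw [Real.rpow_def_of_pos (by linarith), hr]; congr 1; ring
    calc ((1 + ε) ^ ⌊ε * μ⌋₊)⁻¹ = (1 + ε) ^ (-(⌊ε * μ⌋₊ : ℝ)) := by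
          rw [Real.rpow_neg (by linarith), Real.rpow_natCast]
      _ ≤ (1 + ε) ^ (1 + -(ε * μ)) :=
          Real.rpow_le_rpow_of_exponent_le (by linarith) (by linarith)
      _ = (1 + ε) * Real.exp (-r * μ) := by
          rw [Real.rpow_add (by linarith), Real.rpow_one, hexp]
  have hpow : μ ^ (s + 1) = μ ^ s * μ := by rw [Real.rpow_add hμ, Real.rpow_one]
  have hs : 0 < μ ^ s := Real.rpow_pos_of_pos hμ s
  have habs : |A * μ * (C * μ ^ s + D)| ≤ |A * C| * μ ^ (s + 1) + |A * D| * μ ^ (1 : ℝ) := by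
    rw [hpow, Real.rpow_one,
      show A * μ * (C * μ ^ s + D) = A * C * (μ ^ s * μ) + A * D * μ by ring]
    refine (abs_add_le _ _).trans (le_of_eq ?_)
    rw [abs_mul (A * C), abs_mul (A * D), abs_of_pos hμ, abs_of_pos (mul_pos hs hμ)]
  have hpos : 0 < ((1 + ε) ^ ⌊ε * μ⌋₊)⁻¹ := by positivity
  rw [Real.norm_eq_abs, abs_mul, abs_of_pos hpos]
  calc |A * μ * (C * μ ^ s + D)| * ((1 + ε) ^ ⌊ε * μ⌋₊)⁻¹
      ≤ (|A * C| * μ ^ (s + 1) + |A * D| * μ ^ (1 : ℝ)) * ((1 + ε) * Real.exp (-r * μ)) := by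
        gcongr
    _ = _ := by ring

lemma eventually_abs_mul_rpow_sub_lt {c : ℕ → ℝ} {s L : ℝ}
    (hc : Tendsto (fun k : ℕ => c k * (k : ℝ) ^ s) atTop (nhds L)) {η : ℝ} (hη : 0 < η) :
    ∃ δ > 0, ∀ᶠ μ : ℝ in atTop, ∀ k : ℕ, |(k : ℝ) - μ| < δ * μ → |c k * μ ^ s - L| < η := by
  have hcont : ContinuousAt (fun p : ℝ × ℝ => p.1 * p.2 ^ (-s)) (L, 1) :=
    continuousAt_fst.mul (continuousAt_snd.rpow_const (Or.inl one_ne_zero))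
  obtain ⟨δ, hδ, hball⟩ := Metric.continuousAt_iff.1 hcont η hη
  obtain ⟨K, hK⟩ := Metric.tendsto_atTop.1 hc δ hδ
  refine ⟨min δ (1 / 2), by positivity, ?_⟩
  filter_upwards [eventually_gt_atTop (0 : ℝ), eventually_ge_atTop (2 * (K : ℝ))] with μ hμ hμK k hk
  have hk1 : |(k : ℝ) - μ| < δ * μ := hk.trans_le (by gcongr; exact min_le_left _ _)
  have hk2 : |(k : ℝ) - μ| < 1 / 2 * μ := hk.trans_le (by gcongr; exact min_le_right _ _)
  have hkμ : μ / 2 < k := by linarith [(abs_lt.1 hk2).1]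
  have hk0 : (0 : ℝ) < k := by linarith
  have hKk : K ≤ k := by
    have : (K : ℝ) ≤ k := by linarith
    exact_mod_cast this
  have hquot : dist ((k : ℝ) / μ) 1 < δ := by
    rw [Real.dist_eq, div_sub_one hμ.ne', abs_div, abs_of_pos hμ, div_lt_iff₀ hμ]
    exact hk1
  have h := hball (x := (c k * (k : ℝ) ^ s, (k : ℝ) / μ))
    (by rw [Prod.dist_eq]; exact max_lt (hK k hKk) hquot)
  rw [Real.dist_eq] at h
  have hk_ne : (k : ℝ) ^ s ≠ 0 := (Real.rpow_pos_of_pos hk0 s).ne'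
  have hcalc : c k * (k : ℝ) ^ s * ((k : ℝ) / μ) ^ (-s) = c k * μ ^ s := by
    rw [Real.rpow_neg (by positivity), Real.div_rpow hk0.le hμ.le, inv_div]
    field_simp
  simpa [hcalc] using h

lemma exists_abs_le_of_tendsto_mul_rpow {c : ℕ → ℝ} {s L : ℝ} (hs : 0 ≤ s)
    (hc : Tendsto (fun k : ℕ => c k * (k : ℝ) ^ s) atTop (nhds L)) :
    ∃ C, 0 ≤ C ∧ ∀ k, |c k| ≤ C := by
  obtain ⟨B, hB⟩ := hc.abs.bddAbove_range
  refine ⟨max B |c 0|, le_max_of_le_right (abs_nonneg _), fun k => ?_⟩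
  rcases Nat.eq_zero_or_pos k with rfl | hk
  · exact le_max_right _ _
  · refine le_max_of_le_left (le_trans ?_ (hB ⟨k, rfl⟩))
    have h1 : (1 : ℝ) ≤ (k : ℝ) ^ s := Real.one_le_rpow (by exact_mod_cast hk) hs
    simp only [abs_mul]
    exact le_mul_of_one_le_right (abs_nonneg _) (h1.trans (le_abs_self _))

lemma chebWeight_tail {n N k : ℕ} (hk : k ≤ n) (h : n < N) {μ ε : ℝ}
    (hμ : N * μ = n * (n + 1)) (hμ0 : 0 < μ) (hε : 0 < ε) (hfar : 2 * ε * μ ≤ |(k : ℝ) - μ|) :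
    (chebWeight n N k : ℝ) ≤ (n + N + 1).choose n * ((1 + ε) ^ ⌊ε * μ⌋₊)⁻¹ := by
  have hN : (0 : ℝ) < N := by exact_mod_cast (Nat.zero_le n).trans_lt h
  have hfl : (⌊ε * μ⌋₊ : ℝ) ≤ ε * μ := Nat.floor_le (by positivity)
  have hp : 0 < (1 + ε) ^ ⌊ε * μ⌋₊ := by positivity
  rw [← div_eq_mul_inv, le_div_iff₀ hp, mul_comm]
  rcases le_abs.1 hfar with h1 | h1
  · have hle : ⌊ε * μ⌋₊ ≤ k := by
      have : (⌊ε * μ⌋₊ : ℝ) ≤ k := by nlinarith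
      exact_mod_cast this
    have := chebWeight_upper_tail h hε.le ⌊ε * μ⌋₊ (k - ⌊ε * μ⌋₊) (by
      rw [← hμ, mul_left_comm, Nat.cast_sub hle]
      gcongr
      linarith) (by omega)
    rwa [Nat.sub_add_cancel hle] at this
  · refine chebWeight_lower_tail h hε.le _ k ?_ hk
    rw [← hμ, mul_left_comm]
    gcongr
    have : (k : ℝ) + ⌊ε * μ⌋₊ ≤ (1 - ε) * μ := by linarith
    nlinarith [mul_pos (mul_pos hε hε) hμ0]

lemma eventually_abs_sum_chebWeight_sub_le {c : ℕ → ℝ} {s L : ℝ} (hs : 0 ≤ s)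
    (hc : Tendsto (fun k : ℕ => c k * (k : ℝ) ^ s) atTop (nhds L)) (A : ℝ) {η : ℝ} (hη : 0 < η) :
    ∀ᶠ μ : ℝ in atTop, ∀ n N : ℕ, n < N → N * μ = n * (n + 1) → (n : ℝ) + 1 ≤ A * μ →
      |(∑ k ∈ Finset.range (n + 1), (chebWeight n N k : ℝ) * c k) /
        ((n + N + 1).choose n : ℝ) * μ ^ s - L| ≤ 2 * η := by
  obtain ⟨δ, hδ, hnear⟩ := eventually_abs_mul_rpow_sub_lt hc hη
  obtain ⟨C, hC0, hC⟩ := exists_abs_le_of_tendsto_mul_rpow hs hc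
  have hfar := (tendsto_mul_rpow_mul_pow_floor A C |L| s (half_pos hδ)).eventually_le_const hη
  filter_upwards [hnear, hfar, eventually_gt_atTop (0 : ℝ)] with μ hnear hfar hμ n N h hμN hA
  set Q : ℝ := ((1 + δ / 2) ^ ⌊δ / 2 * μ⌋₊)⁻¹
  have hQ : 0 < Q := by positivity
  have hs0 : 0 < μ ^ s := Real.rpow_pos_of_pos hμ s
  have hW : (0 : ℝ) < ((n + N + 1).choose n : ℝ) := by
    exact_mod_cast Nat.choose_pos (by omega)
  have hsum : ∑ k ∈ Finset.range (n + 1), (chebWeight n N k : ℝ) = (n + N + 1).choose n := by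
    exact_mod_cast sum_chebWeight h.le
  set W : ℝ := ((n + N + 1).choose n : ℝ)
  have hterm : ∀ k ∈ Finset.range (n + 1), |(chebWeight n N k : ℝ) * (c k * μ ^ s - L)| ≤
      chebWeight n N k * η + W * Q * (C * μ ^ s + |L|) := by
    intro k hk
    have hw : (0 : ℝ) ≤ chebWeight n N k := Nat.cast_nonneg _
    rw [abs_mul, abs_of_nonneg hw]
    rcases lt_or_ge |(k : ℝ) - μ| (δ * μ) with hlt | hge
    · have h1 := mul_le_mul_of_nonneg_left (hnear k hlt).le hw
      have h2 : 0 ≤ W * Q * (C * μ ^ s + |L|) := by positivity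
      linarith
    · have h1 : (chebWeight n N k : ℝ) ≤ W * Q :=
        chebWeight_tail (Nat.lt_succ_iff.1 (Finset.mem_range.1 hk)) h hμN hμ (half_pos hδ)
          (by linarith)
      have h2 : |c k * μ ^ s - L| ≤ C * μ ^ s + |L| := by
        refine (abs_sub _ _).trans ?_
        rw [abs_mul, abs_of_pos hs0]
        gcongr
        exact hC k
      have h3 := mul_le_mul h1 h2 (abs_nonneg _) (by positivity)
      have h4 := mul_nonneg hw hη.le
      linarith
  have hrw : (∑ k ∈ Finset.range (n + 1), (chebWeight n N k : ℝ) * c k) / W * μ ^ s - L =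
      (∑ k ∈ Finset.range (n + 1), (chebWeight n N k : ℝ) * (c k * μ ^ s - L)) / W := by
    simp only [mul_sub, Finset.sum_sub_distrib, ← mul_assoc, ← Finset.sum_mul, hsum]
    field_simp
  rw [hrw, abs_div, abs_of_pos hW, div_le_iff₀ hW]
  calc |∑ k ∈ Finset.range (n + 1), (chebWeight n N k : ℝ) * (c k * μ ^ s - L)|
      ≤ ∑ k ∈ Finset.range (n + 1), (chebWeight n N k * η + W * Q * (C * μ ^ s + |L|)) :=
        (Finset.abs_sum_le_sum_abs _ _).trans (Finset.sum_le_sum hterm)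
    _ = W * η + W * (((n : ℝ) + 1) * (C * μ ^ s + |L|) * Q) := by
        rw [Finset.sum_add_distrib, ← Finset.sum_mul, hsum]
        simp only [Finset.sum_const, Finset.card_range, nsmul_eq_mul]
        push_cast
        ring
    _ ≤ W * η + W * (A * μ * (C * μ ^ s + |L|) * Q) := by gcongr
    _ ≤ W * η + W * η := by gcongr
    _ = 2 * η * W := by ring

/-- For fixed `x ≥ 0` and `b ∈ (0,1)`, with `n = ⌊bN⌋`,
`t_n(x, N+1) = (-1)^{n+1} Γ(n+N+2) N^x n^{-2x-2} Γ(x+1) / (Γ(N+1) π) · (sin(πx) + o(1))`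
as `N → ∞`, i.e. the normalized quotient tends to `sin(πx)`. -/
theorem tcheb_asymptotics_nonneg_x (x b : ℝ) (hx : 0 ≤ x) (hb : b ∈ Set.Ioo (0 : ℝ) 1) :
    Tendsto
      (fun N : ℕ =>
        (-1 : ℝ) ^ (⌊b * (N : ℝ)⌋₊ + 1) * Real.pi * tcheb (⌊b * (N : ℝ)⌋₊) N x *
            Real.Gamma ((N : ℝ) + 1) * (N : ℝ) ^ (-x) *
            ((⌊b * (N : ℝ)⌋₊ : ℝ)) ^ (2 * x + 2) /
          (Real.Gamma ((⌊b * (N : ℝ)⌋₊ : ℝ) + (N : ℝ) + 2) * Real.Gamma (x + 1)))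
      atTop (nhds (Real.sin (Real.pi * x))) := by
  set n : ℕ → ℕ := fun N => ⌊b * (N : ℝ)⌋₊ with hn
  have hb0 : 0 < b := hb.1
  have hratio : Tendsto (fun N : ℕ => (n N : ℝ) / N) atTop (nhds b) :=
    (tendsto_nat_floor_mul_div_atTop hb0.le).comp tendsto_natCast_atTop_atTop
  have hn_top : Tendsto n atTop atTop :=
    tendsto_nat_floor_atTop.comp (tendsto_natCast_atTop_atTop.const_mul_atTop hb0)
  have hn_top' : Tendsto (fun N => (n N : ℝ)) atTop atTop :=
    tendsto_natCast_atTop_atTop.comp hn_top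
  have hμ_top : Tendsto (fun N : ℕ => (n N : ℝ) / N * (n N + 1)) atTop atTop :=
    hratio.pos_mul_atTop hb0 (tendsto_atTop_add_const_right _ _ hn_top')
  have hmean : Tendsto (fun N : ℕ =>
      (∑ k ∈ Finset.range (n N + 1), (chebWeight (n N) N k : ℝ) * binomCoeff x k) /
        ((n N + N + 1).choose (n N) : ℝ) * ((n N : ℝ) / N * (n N + 1)) ^ (x + 1)) atTop
      (nhds (-(Real.sin (Real.pi * x) * Real.Gamma (x + 1) / Real.pi))) := by
    rw [Metric.tendsto_nhds]
    intro η hη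
    have hclose := hμ_top.eventually (eventually_abs_sum_chebWeight_sub_le (by linarith)
      (tendsto_binomCoeff_mul_rpow x hx) (2 / b) (show 0 < η / 3 by positivity))
    filter_upwards [hclose, eventually_gt_atTop 0,
      hratio.eventually_const_le (half_lt_self hb0)] with N hclose hN hhalf
    have hN0 : (0 : ℝ) < N := by exact_mod_cast hN
    rw [Real.dist_eq]
    refine (hclose (n N) N ?_ ?_ ?_).trans_lt (by linarith)
    · rw [hn, Nat.floor_lt (by positivity)]
      nlinarith [hb.2]
    · field_simp
    · rw [← mul_assoc]
      refine le_mul_of_one_le_left (by positivity) ?_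
      rw [div_mul_eq_mul_div, le_div_iff₀ hb0]
      linarith
  have hN1 : Tendsto (fun N : ℕ => (N : ℝ) / (N + 1)) atTop (nhds 1) :=
    tendsto_natCast_div_add_atTop 1
  have hn1 : Tendsto (fun N : ℕ => ((n N : ℝ) / (n N + 1)) ^ (x + 1)) atTop (nhds 1) := by
    have := (hN1.comp hn_top).rpow_const (p := x + 1) (Or.inl one_ne_zero)
    simpa using this
  have hΓ : Real.Gamma (x + 1) ≠ 0 := (Real.Gamma_pos_of_pos (by linarith)).ne'
  have hpi := Real.pi_ne_zero
  have hlim := ((hmean.const_mul (-(Real.pi / Real.Gamma (x + 1)))).mul hN1).mul hn1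
  have hval : -(Real.pi / Real.Gamma (x + 1)) *
      -(Real.sin (Real.pi * x) * Real.Gamma (x + 1) / Real.pi) * 1 * 1 =
        Real.sin (Real.pi * x) := by
    field_simp
  rw [hval] at hlim
  refine hlim.congr' ?_
  filter_upwards [eventually_gt_atTop 0, hn_top.eventually_gt_atTop 0] with N hN hnN
  have hN0 : (0 : ℝ) < N := by exact_mod_cast hN
  have hn0 : (0 : ℝ) < n N := by exact_mod_cast hnN
  have hle : n N ≤ N := Nat.floor_le_of_le (by nlinarith [hb.2])
  change _ = (-1 : ℝ) ^ (n N + 1) * Real.pi * tcheb (n N) N x * Real.Gamma ((N : ℝ) + 1) *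
    (N : ℝ) ^ (-x) * (n N : ℝ) ^ (2 * x + 2) /
      (Real.Gamma ((n N : ℝ) + (N : ℝ) + 2) * Real.Gamma (x + 1))
  rw [tcheb_eq_sum_chebWeight hle]
  generalize n N = m at *
  generalize ∑ k ∈ Finset.range (m + 1), (chebWeight m N k : ℝ) * binomCoeff x k = S
  have hG1 : Real.Gamma ((m : ℝ) + N + 2) = ((m + N + 1).factorial : ℝ) := by
    rw [← Real.Gamma_nat_eq_factorial]; push_cast; ring_nf
  have hchoose : ((m + N + 1).choose m : ℝ) * m.factorial * ((N + 1) * N.factorial) =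
      (m + N + 1).factorial := by
    have h1 := Nat.choose_mul_factorial_mul_factorial (show m ≤ m + N + 1 by omega)
    rw [show m + N + 1 - m = N + 1 by omega, Nat.factorial_succ] at h1
    exact_mod_cast h1
  have hC : ((m + N + 1).choose m : ℝ) ≠ 0 := by
    exact_mod_cast (Nat.choose_pos (by omega)).ne'
  have hsign : (-1 : ℝ) ^ (m + 1) * (-1) ^ m = -1 := by
    rw [← pow_add, show m + 1 + m = 2 * m + 1 by ring, pow_succ, pow_mul]; simp
  have hpow : ((m : ℝ) / N * (m + 1)) ^ (x + 1) * ((m : ℝ) / (m + 1)) ^ (x + 1) =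
      (m : ℝ) ^ (2 * x + 2) * (N : ℝ) ^ (-x) / N := by
    rw [← Real.mul_rpow (by positivity) (by positivity),
      show (m : ℝ) / N * (m + 1) * (m / (m + 1)) = m * m / N by field_simp,
      Real.div_rpow (by positivity) hN0.le, Real.mul_rpow hn0.le hn0.le, ← Real.rpow_add hn0,
      Real.rpow_add hN0, Real.rpow_one, Real.rpow_neg hN0.le]
    rw [show x + 1 + (x + 1) = 2 * x + 2 by ring]
    field_simp
  rw [hG1, ← hchoose, Real.Gamma_nat_eq_factorial]
  have hmf : (m.factorial : ℝ) ≠ 0 := by positivity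
  have hNf : (N.factorial : ℝ) ≠ 0 := by positivity
  have hN1' : (N : ℝ) + 1 ≠ 0 := by positivity
  generalize ((m + N + 1).choose m : ℝ) = W at *
  calc _ = -(Real.pi / Real.Gamma (x + 1)) * (S / W) * ((N : ℝ) / (N + 1)) *
        (((m : ℝ) / N * (m + 1)) ^ (x + 1) * ((m : ℝ) / (m + 1)) ^ (x + 1)) := by ring
    _ = ((-1 : ℝ) ^ (m + 1) * (-1) ^ m) * Real.pi * (m.factorial * S) * N.factorial * (N : ℝ) ^ (-x) *
        (m : ℝ) ^ (2 * x + 2) / (W * m.factorial * ((N + 1) * N.factorial) *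
          Real.Gamma (x + 1)) := by
        rw [hpow, hsign]
        field_simp
    _ = _ := by ring
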